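/- Let A ∈ ℝ^{m×2n}, b ∈ ℝ^m, and let x_1, y_1, …, y_k ∈ ℝ^n and λ_1, …, λ_k, μ_1, …, μ_{k-1} ≥ 0 satisfy the (point) condition A(x_1; x_1 + Σ_{i=1}^k y_i) ≤ b and the (ray) conditions A(y_1; λ_1 y_1) ≤ 0 and A(y_i; λ_i y_i + μ_{i-1} y_{i-1}) ≤ 0 for 1 < i ≤ k. Set Y = (y_1 … y_k) ∈ ℝ^{n×k} and let U ∈ ℝ^{k×k} be the upper bidiagonal matrix with U_{ii} = λ_i and U_{i,i+1} = μ_i (all other entries 0). Then for every t ∈ ℕ (with the empty sum equal to 0): A( x_1 + Σ_{j=0}^{t-1} Y U^j 1 ; x_1 + Σ_{j=0}^{t} Y U^j 1 ) ≤ b, where 1 denotes the all-ones vector in ℝ^k. -/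

import Mathlib

open Matrix Finset

/-- The matrix `Y` whose columns are the vectors `y_1, …, y_k`. -/
def Ymat {n k : ℕ} (y : Fin k → Fin n → ℝ) : Matrix (Fin n) (Fin k) ℝ :=
  Matrix.of fun i j => y j i

/-- The upper bidiagonal matrix `U` with `U_{ii} = λ_i` and `U_{i,i+1} = μ_i`. -/
def Umat {k : ℕ} (lam : Fin k → ℝ) (mu : Fin (k - 1) → ℝ) : Matrix (Fin k) (Fin k) ℝ :=
  Matrix.of fun i j =>
    if (i : ℕ) = (j : ℕ) then lam i
    else if h : (j : ℕ) = (i : ℕ) + 1 then mu ⟨(i : ℕ), by have := j.isLt; omega⟩ else 0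

lemma Ymat_mul_Umat_col_of_val_eq_zero {n k : ℕ} (y : Fin k → Fin n → ℝ)
    (lam : Fin k → ℝ) (mu : Fin (k - 1) → ℝ) {i : Fin k} (hi : (i : ℕ) = 0) :
    (Ymat y * Umat lam mu).col i = lam i • y i := by
  ext a
  simp only [Matrix.col_apply, Matrix.mul_apply, Ymat, Umat, Matrix.of_apply,
    Pi.smul_apply, smul_eq_mul]
  rw [Finset.sum_eq_single i]
  · rw [if_pos rfl, mul_comm]
  · intro l _ hl
    rw [if_neg (Fin.val_ne_of_ne hl), dif_neg (by omega), mul_zero]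
  · exact fun h => absurd (Finset.mem_univ i) h

lemma Ymat_mul_Umat_col_of_val_eq_succ {n k : ℕ} (y : Fin k → Fin n → ℝ)
    (lam : Fin k → ℝ) (mu : Fin (k - 1) → ℝ) {i j : Fin k} (hij : (i : ℕ) = j + 1)
    (hj : (j : ℕ) < k - 1) :
    (Ymat y * Umat lam mu).col i = lam i • y i + mu ⟨j, hj⟩ • y j := by
  ext a
  simp only [Matrix.col_apply, Matrix.mul_apply, Ymat, Umat, Matrix.of_apply, Pi.add_apply,
    Pi.smul_apply, smul_eq_mul]
  have hne : i ≠ j := fun h => by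
    rw [h] at hij
    omega
  rw [Finset.sum_eq_add_of_mem i j (Finset.mem_univ i) (Finset.mem_univ j) hne]
  · rw [if_pos rfl, if_neg (Fin.val_ne_of_ne hne.symm), dif_pos hij, mul_comm, mul_comm (y j a)]
  · rintro l - ⟨hli, hlj⟩
    have hlj' := Fin.val_ne_of_ne hlj
    rw [if_neg (Fin.val_ne_of_ne hli), dif_neg (by omega), mul_zero]

lemma Umat_nonneg {k : ℕ} {lam : Fin k → ℝ} {mu : Fin (k - 1) → ℝ}
    (hlam : ∀ i, 0 ≤ lam i) (hmu : ∀ i, 0 ≤ mu i) (i j : Fin k) : 0 ≤ Umat lam mu i j := by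
  simp only [Umat, Matrix.of_apply]
  split_ifs
  exacts [hlam i, hmu _, le_rfl]

lemma pow_mulVec_nonneg {ι : Type*} [Fintype ι] [DecidableEq ι] {M : Matrix ι ι ℝ}
    (hM : ∀ i j, 0 ≤ M i j) {v : ι → ℝ} (hv : 0 ≤ v) (t : ℕ) : 0 ≤ M ^ t *ᵥ v := by
  induction t with
  | zero => simpa using hv
  | succ t ih =>
    rw [pow_succ', ← Matrix.mulVec_mulVec]
    exact fun i => Finset.sum_nonneg fun j _ => mul_nonneg (hM i j) (ih j)

/-- A nonnegative combination of recession directions is a recession direction. -/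
lemma mulVec_elim_nonpos {ι κ κ' σ : Type*} [Fintype κ] [Fintype κ'] [Fintype σ]
    {A : Matrix ι (κ ⊕ κ') ℝ} {P : Matrix κ σ ℝ} {Q : Matrix κ' σ ℝ}
    (h : ∀ i, A *ᵥ Sum.elim (P.col i) (Q.col i) ≤ 0) {v : σ → ℝ} (hv : 0 ≤ v) :
    A *ᵥ Sum.elim (P *ᵥ v) (Q *ᵥ v) ≤ 0 := by
  rw [← Matrix.fromRows_mulVec, Matrix.mulVec_mulVec]
  intro r
  refine Finset.sum_nonpos fun i _ => mul_nonpos_of_nonpos_of_nonneg ?_ (hv i)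
  have key : (A * Matrix.fromRows P Q) r i = (A *ᵥ Sum.elim (P.col i) (Q.col i)) r := by
    simp [Matrix.mul_apply, Matrix.mulVec, dotProduct]
  exact key.trans_le (h i r)

/-- If `x₁, y₁, …, y_k, λ₁, …, λ_k, μ₁, …, μ_{k-1}` satisfy the (point) and (ray)
conditions of a geometric nontermination argument for the loop `{(x,x') : A (x;x') ≤ b}`,
then for every `t ∈ ℕ` the pair
`(x₁ + Σ_{j=0}^{t-1} Y Uʲ 1, x₁ + Σ_{j=0}^{t} Y Uʲ 1)` satisfies the loop transition. -/
theorem gnta_step {n m k : ℕ}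
    (A : Matrix (Fin m) (Fin n ⊕ Fin n) ℝ) (b : Fin m → ℝ)
    (x1 : Fin n → ℝ) (y : Fin k → Fin n → ℝ)
    (lam : Fin k → ℝ) (mu : Fin (k - 1) → ℝ)
    (hlam : ∀ i, 0 ≤ lam i) (hmu : ∀ i, 0 ≤ mu i)
    -- (point)
    (hpoint : A *ᵥ Sum.elim x1 (x1 + ∑ i, y i) ≤ b)
    -- (ray)
    (hray : ∀ i : Fin k,
      A *ᵥ Sum.elim (y i)
        (lam i • y i +
          if h : 0 < (i : ℕ) then
            mu ⟨(i : ℕ) - 1, by have := i.isLt; omega⟩ •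
              y ⟨(i : ℕ) - 1, by have := i.isLt; omega⟩
          else 0) ≤ 0) :
    ∀ t : ℕ,
      A *ᵥ Sum.elim
        (x1 + ∑ j ∈ Finset.range t, (Ymat y * Umat lam mu ^ j) *ᵥ (fun _ => (1 : ℝ)))
        (x1 + ∑ j ∈ Finset.range (t + 1), (Ymat y * Umat lam mu ^ j) *ᵥ (fun _ => (1 : ℝ)))
      ≤ b := by
  have hone : (0 : Fin k → ℝ) ≤ fun _ => 1 := fun _ => zero_le_one
  have hcol : ∀ i, A *ᵥ Sum.elim ((Ymat y).col i) ((Ymat y * Umat lam mu).col i) ≤ 0 := by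
    intro i
    have hr := hray i
    split_ifs at hr with hpos
    · rw [Ymat_mul_Umat_col_of_val_eq_succ y lam mu (j := ⟨(i : ℕ) - 1, by omega⟩)
        (Nat.sub_add_cancel hpos).symm (Nat.sub_lt_sub_right hpos i.isLt)]
      exact hr
    · rw [Ymat_mul_Umat_col_of_val_eq_zero y lam mu (by omega)]
      rwa [add_zero] at hr
  intro t
  induction t with
  | zero =>
    have hY : Ymat y *ᵥ (fun _ => (1 : ℝ)) = ∑ i, y i := by
      ext a
      simp [Ymat, Matrix.mulVec, dotProduct]
    simpa [hY] using hpoint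
  | succ t ih =>
    have hstep := mulVec_elim_nonpos hcol
      (pow_mulVec_nonneg (Umat_nonneg hlam hmu) hone t)
    rw [Matrix.mulVec_mulVec, Matrix.mulVec_mulVec, Matrix.mul_assoc, ← pow_succ'] at hstep
    rw [Finset.sum_range_succ _ (t + 1)]
    nth_rewrite 1 [Finset.sum_range_succ]
    rw [← add_assoc, ← add_assoc, Sum.elim_add_add, Matrix.mulVec_add]
    simpa using add_le_add ih hstep
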